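/- Let 0 < α < 1, θ > −α and γ ≥ 0. Then the three-parameter Indian Buffet Process weights V^{IBP,α,θ}(γ) form an (α,θ)-solution: Σ_{j=0}^{∞} V^{IBP,α,θ}_{1,j}(γ) = 1 and, for every n ∈ ℕ and k ∈ ℕ₀, V^{IBP,α,θ}_{n,k}(γ) = Σ_{j=0}^{∞} C(k+j, j) ((θ+α)_{n↑})^j (θ+n)^k V^{IBP,α,θ}_{n+1,k+j}(γ). -/

import Mathlib

open scoped BigOperators

/-- Rising factorial `(x)_{j↑} = x(x+1)⋯(x+j-1)`. -/
noncomputable def risingFac (x : ℝ) (j : ℕ) : ℝ :=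
  ∏ i ∈ Finset.range j, (x + i)

/-- Indian Buffet Process weights `V^{IBP,α,θ}_{n,k}(γ)`. -/
noncomputable def VIBP (α θ γ : ℝ) (n k : ℕ) : ℝ :=
  (1 / (Nat.factorial k : ℝ)) * (γ / risingFac (θ + 1) (n - 1)) ^ k *
    Real.exp (-(∑ i ∈ Finset.Icc 1 n,
      γ * risingFac (α + θ) (i - 1) / risingFac (1 + θ) (i - 1)))

theorem hasSum_pow_div_factorial (x : ℝ) :
    HasSum (fun j : ℕ => x ^ j / (Nat.factorial j : ℝ)) (Real.exp x) := by
  rw [Real.exp_eq_exp_ℝ]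
  exact NormedSpace.expSeries_div_hasSum_exp x

theorem risingFac_succ (x : ℝ) (j : ℕ) :
    risingFac x (j + 1) = risingFac x j * (x + j) :=
  Finset.prod_range_succ _ _

theorem VIBP_one (α θ γ : ℝ) (k : ℕ) :
    VIBP α θ γ 1 k = γ ^ k / (Nat.factorial k : ℝ) * Real.exp (-γ) := by
  simp [VIBP, risingFac, div_eq_inv_mul]

theorem VIBP_succ_add (α θ γ : ℝ) (m k j : ℕ) (hθ : θ + (m + 1 : ℕ) ≠ 0) :
    (Nat.choose (k + j) j : ℝ) * (risingFac (θ + α) (m + 1)) ^ j *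
        (θ + (m + 1 : ℕ)) ^ k * VIBP α θ γ (m + 1 + 1) (k + j) =
      VIBP α θ γ (m + 1) k *
        Real.exp (-(γ * risingFac (θ + α) (m + 1) / risingFac (θ + 1) (m + 1))) *
        ((γ * risingFac (θ + α) (m + 1) / risingFac (θ + 1) (m + 1)) ^ j /
          (Nat.factorial j : ℝ)) := by
  have hchoose : (Nat.choose (k + j) j : ℝ) * (1 / (Nat.factorial (k + j) : ℝ)) =
      1 / (Nat.factorial k : ℝ) * (1 / (Nat.factorial j : ℝ)) := by
    have h : (Nat.choose (k + j) j : ℝ) * Nat.factorial k * Nat.factorial j =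
        Nat.factorial (k + j) := by
      exact_mod_cast Nat.add_choose_mul_factorial_mul_factorial k j
    have hk : (Nat.factorial k : ℝ) ≠ 0 := by positivity
    have hj : (Nat.factorial j : ℝ) ≠ 0 := by positivity
    have hkj : (Nat.factorial (k + j) : ℝ) ≠ 0 := by positivity
    field_simp
    linarith
  have hbase : (θ + (m + 1 : ℕ)) * (γ / risingFac (θ + 1) (m + 1)) =
      γ / risingFac (θ + 1) m := by
    have hc : θ + 1 + (m : ℝ) = θ + (m + 1 : ℕ) := by push_cast; ring
    rw [risingFac_succ, hc, mul_comm, div_mul_eq_mul_div, mul_div_mul_right _ _ hθ]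
  unfold VIBP
  rw [Finset.sum_Icc_succ_top (by omega : 1 ≤ m + 1 + 1), neg_add, Real.exp_add]
  simp only [Nat.add_sub_cancel, add_comm α θ, add_comm 1 θ]
  rw [← hbase, pow_add, mul_div_right_comm γ, mul_pow, mul_pow]
  linear_combination (risingFac (θ + α) (m + 1) ^ j * (θ + (m + 1 : ℕ)) ^ k *
    (γ / risingFac (θ + 1) (m + 1)) ^ k * (γ / risingFac (θ + 1) (m + 1)) ^ j *
    Real.exp (-∑ i ∈ Finset.Icc 1 (m + 1),
      γ * risingFac (θ + α) (i - 1) / risingFac (θ + 1) (i - 1)) *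
    Real.exp (-(γ / risingFac (θ + 1) (m + 1) * risingFac (θ + α) (m + 1)))) * hchoose

/-- The three-parameter IBP weights form an `(α,θ)`-solution. -/
theorem stmt_7
    (α θ γ : ℝ) (hα0 : 0 < α) (hα1 : α < 1) (hθ : -α < θ) (hγ : 0 ≤ γ) :
    HasSum (fun j => VIBP α θ γ 1 j) 1 ∧
    ∀ n : ℕ, 1 ≤ n → ∀ k : ℕ,
      HasSum
        (fun j : ℕ =>
          (Nat.choose (k + j) j : ℝ) * (risingFac (θ + α) n) ^ j *
            (θ + (n : ℝ)) ^ k * VIBP α θ γ (n + 1) (k + j))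
        (VIBP α θ γ n k) := by
  refine ⟨?_, fun n hn k => ?_⟩
  · simpa only [VIBP_one, ← Real.exp_add, add_neg_cancel, Real.exp_zero] using
      (hasSum_pow_div_factorial γ).mul_right (Real.exp (-γ))
  · obtain ⟨m, rfl⟩ := Nat.exists_eq_add_of_le' hn
    have hpos : θ + (m + 1 : ℕ) ≠ 0 := by
      have : (0 : ℝ) ≤ m := m.cast_nonneg
      push_cast
      linarith
    simp only [VIBP_succ_add α θ γ m k _ hpos]
    have h := (hasSum_pow_div_factorial
      (γ * risingFac (θ + α) (m + 1) / risingFac (θ + 1) (m + 1))).mul_left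
      (VIBP α θ γ (m + 1) k *
        Real.exp (-(γ * risingFac (θ + α) (m + 1) / risingFac (θ + 1) (m + 1))))
    rwa [mul_assoc, ← Real.exp_add, neg_add_cancel, Real.exp_zero, mul_one] at h
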